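/- arXiv:0704.3293 — 2 statements merged into one kernel-verified Lean document; each statement's English description precedes it below -/
import Mathlib

section
/- With the edge-disjoint decomposition setting as given, let r ∈ B and U ⊆ B with r ∉ U. Then | ‖μ_{{r}∪U} − μ_r ⊗ μ_U‖_TV − ‖μ^<_{{r}∪U} − μ^<_r ⊗ μ^<_U‖_TV | ≤ 9·|X|^{2|B|}·‖μ^>_D − ρ_D‖_TV, where μ_r ⊗ μ_U denotes the product of the marginals of μ at r and on U (as a distribution on X^{{r}∪U}), and similarly for μ^<. -/
noncomputable section

open Finset

/-- Product over a set of (unordered) edges of the symmetric weights `ψ`,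
evaluated at the configuration `x`. -/
def edgeW {V X : Type*} (ψ : V → V → X → X → ℝ)
    (hsym : ∀ i j a b, ψ i j a b = ψ j i b a)
    (E : Finset (Sym2 V)) (x : V → X) : ℝ :=
  ∏ e ∈ E, Sym2.lift ⟨fun i j => ψ i j (x i) (x j),
    fun i j => hsym i j (x i) (x j)⟩ e

/-- The probability distribution on `X^V` proportional to the weight `W`. -/
def gibbs {V X : Type*} [Fintype V] [DecidableEq V] [Fintype X]
    (W : (V → X) → ℝ) (x : V → X) : ℝ :=
  W x / ∑ y : V → X, W y

/-- Marginal of a distribution `μ` on `X^V` on the subset `U` of vertices. -/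
def marg {V X : Type*} [Fintype V] [DecidableEq V] [Fintype X] [DecidableEq X]
    (μ : (V → X) → ℝ) (U : Finset V) (y : {i // i ∈ U} → X) : ℝ :=
  ∑ x : V → X, if ∀ i : {i // i ∈ U}, x i.1 = y i then μ x else 0

lemma edgeW_pos {V X : Type*} (ψ : V → V → X → X → ℝ)
    (hsym : ∀ i j a b, ψ i j a b = ψ j i b a) (hpos : ∀ i j a b, 0 < ψ i j a b)
    (E : Finset (Sym2 V)) (x : V → X) : 0 < edgeW ψ hsym E x := by
  refine Finset.prod_pos fun e _ => ?_
  induction e using Sym2.ind with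
  | _ i j => exact hpos i j _ _

lemma edgeW_congr {V X : Type*} (ψ : V → V → X → X → ℝ)
    (hsym : ∀ i j a b, ψ i j a b = ψ j i b a)
    (E : Finset (Sym2 V)) {x y : V → X} (h : ∀ e ∈ E, ∀ i ∈ e, x i = y i) :
    edgeW ψ hsym E x = edgeW ψ hsym E y := by
  refine Finset.prod_congr rfl fun e he => ?_
  have h' := h e he
  induction e using Sym2.ind with
  | _ i j =>
    simp only [Sym2.lift_mk]
    rw [h' i (Sym2.mem_mk_left i j), h' j (Sym2.mem_mk_right i j)]

lemma sum_weight_pos {V X : Type*} [Fintype V] [DecidableEq V] [Fintype X] [Nonempty X]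
    {W : (V → X) → ℝ} (hW : ∀ x, 0 < W x) :
    0 < ∑ x, W x :=
  Finset.sum_pos (fun x _ => hW x) Finset.univ_nonempty

lemma gibbs_nonneg {V X : Type*} [Fintype V] [DecidableEq V] [Fintype X]
    {W : (V → X) → ℝ} (hW : ∀ x, 0 ≤ W x) (x : V → X) :
    0 ≤ gibbs W x :=
  div_nonneg (hW x) (Finset.sum_nonneg fun y _ => hW y)

lemma sum_gibbs {V X : Type*} [Fintype V] [DecidableEq V] [Fintype X] [Nonempty X]
    {W : (V → X) → ℝ} (hW : ∀ x, 0 < W x) :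
    ∑ x, gibbs W x = 1 := by
  simp only [gibbs]
  rw [← Finset.sum_div, div_self (sum_weight_pos hW).ne']

/-- Splitting a configuration on `insert r U` into its parts on `{r}` and `U`. -/
lemma sum_insert_mul_le {V X : Type*} [DecidableEq V] [Fintype X] [DecidableEq X]
    (r : V) (U : Finset V)
    {φ : ({i // i ∈ ({r} : Finset V)} → X) → ℝ} {χ : ({i // i ∈ U} → X) → ℝ}
    (hφ : ∀ a, 0 ≤ φ a) (hχ : ∀ b, 0 ≤ χ b) :
    ∑ y : {i // i ∈ insert r U} → X,
        φ (fun _ => y ⟨r, Finset.mem_insert_self r U⟩) *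
          χ (fun i => y ⟨i.1, Finset.mem_insert_of_mem i.2⟩) ≤
      (∑ a, φ a) * ∑ b, χ b := by
  rw [Finset.sum_mul_sum, ← Fintype.sum_prod_type']
  let s : ({i // i ∈ insert r U} → X) →
      ({i // i ∈ ({r} : Finset V)} → X) × ({i // i ∈ U} → X) :=
    fun y => (fun _ => y ⟨r, Finset.mem_insert_self r U⟩,
      fun i => y ⟨i.1, Finset.mem_insert_of_mem i.2⟩)
  have hs : Function.Injective s := by
    intro y y' h
    ext ⟨i, hi⟩
    rcases Finset.mem_insert.1 hi with rfl | hiU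
    · exact congrFun (congrArg Prod.fst h) ⟨i, Finset.mem_singleton_self i⟩
    · exact congrFun (congrArg Prod.snd h) ⟨i, hiU⟩
  rw [← Finset.sum_image (s := Finset.univ) (g := s) (f := fun p => φ p.1 * χ p.2) hs.injOn]
  exact Finset.sum_le_sum_of_subset_of_nonneg (Finset.subset_univ _)
    fun p _ _ => mul_nonneg (hφ p.1) (hχ p.2)

lemma abs_abs_sub_mul_sub_abs_sub_mul_le {J a b J' a' b' : ℝ} (ha : 0 ≤ a) (hb' : 0 ≤ b') :
    |(|J - a * b| - |J' - a' * b'|)| ≤ |J - J'| + a * |b - b'| + |a - a'| * b' := by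
  have h : J - a * b - (J' - a' * b') = J - J' - a * (b - b') - (a - a') * b' := by ring
  refine (abs_abs_sub_abs_le _ _).trans ?_
  rw [h]
  refine (abs_sub _ _).trans ?_
  rw [abs_mul (a - a'), abs_of_nonneg hb']
  refine add_le_add_left ((abs_sub _ _).trans ?_) _
  rw [abs_mul, abs_of_nonneg ha]

section FiniteMarginals

variable {V X : Type*} [Fintype V] [DecidableEq V] [Fintype X] [DecidableEq X]

lemma marg_nonneg {μ : (V → X) → ℝ} (hμ : ∀ x, 0 ≤ μ x) (S : Finset V)
    (y : {i // i ∈ S} → X) : 0 ≤ marg μ S y := by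
  refine Finset.sum_nonneg fun x _ => ?_
  split_ifs
  exacts [hμ x, le_rfl]

lemma sum_marg (μ : (V → X) → ℝ) (S : Finset V) :
    ∑ y, marg μ S y = ∑ x, μ x := by
  simp only [marg]
  rw [Finset.sum_comm]
  refine Finset.sum_congr rfl fun x _ => ?_
  rw [Finset.sum_eq_single (fun i : {i // i ∈ S} => x i.1)]
  · simp
  · intro y _ hy
    exact if_neg fun h => hy (funext fun i => (h i).symm)
  · simp

lemma sum_abs_marg_sub_le (μ ν : (V → X) → ℝ) (S : Finset V) :
    ∑ y, |marg μ S y - marg ν S y| ≤ ∑ x, |μ x - ν x| := by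
  rw [← sum_marg (fun x => |μ x - ν x|) S]
  refine Finset.sum_le_sum fun y _ => ?_
  simp only [marg]
  rw [← Finset.sum_sub_distrib]
  refine (Finset.abs_sum_le_sum_abs _ _).trans (Finset.sum_le_sum fun x _ => ?_)
  split_ifs <;> simp

/-- The number of configurations with prescribed values on `D`. -/
lemma sum_indicator_eqOn [Nonempty X] (D : Finset V) (x : V → X) :
    (∑ y : V → X, if ∀ i : {i // i ∈ D}, y i.1 = x i.1 then (1 : ℝ) else 0) =
      (Fintype.card X : ℝ) ^ Fintype.card V / (Fintype.card X : ℝ) ^ D.card := by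
  have hq : (Fintype.card X : ℝ) ≠ 0 := by exact_mod_cast Fintype.card_ne_zero
  have hset : (Finset.univ.filter fun y : V → X => ∀ i : {i // i ∈ D}, y i.1 = x i.1) =
      Fintype.piFinset fun i => if i ∈ D then {x i} else Finset.univ := by
    ext y
    simp only [Finset.mem_filter, Finset.mem_univ, true_and, Fintype.mem_piFinset,
      Subtype.forall]
    refine forall_congr' fun i => ?_
    by_cases hi : i ∈ D <;> simp [hi]
  have hterm : ∀ i : V, (if i ∈ D then {x i} else (Finset.univ : Finset X)).card =
      if i ∈ D then 1 else Fintype.card X := by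
    intro i
    split_ifs <;> simp
  rw [Finset.sum_boole, hset, Fintype.card_piFinset, eq_div_iff (pow_ne_zero _ hq)]
  simp only [hterm]
  rw [Finset.prod_ite]
  simp only [Finset.prod_const, one_pow, one_mul]
  rw [Nat.cast_pow, ← pow_add]
  congr 1
  have h := Finset.card_filter_add_card_filter_not (s := (Finset.univ : Finset V)) (· ∈ D)
  have h' : (Finset.univ.filter (· ∈ D)) = D := by ext; simp
  rw [h', Finset.card_univ] at h
  omega

/-- Replacing a weight that depends on `D ∪ Bᶜ` by its marginal on `D`, when tested against a
function that depends on `B`. -/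
lemma sum_mul_marg [Nonempty X] {B D : Finset V} (hDB : D ⊆ B) {g W : (V → X) → ℝ}
    (hg : ∀ x y : V → X, (∀ i ∈ B, x i = y i) → g x = g y)
    (hW : ∀ x y : V → X, (∀ i, i ∉ B ∨ i ∈ D → x i = y i) → W x = W y) :
    ∑ x, g x * marg W D (fun i => x i.1) =
      (Fintype.card X : ℝ) ^ Fintype.card V / (Fintype.card X : ℝ) ^ D.card *
        ∑ x, g x * W x := by
  let mix : (V → X) → (V → X) → V → X := fun x y i => if i ∈ B then x i else y i
  let σ : (V → X) × (V → X) → (V → X) × (V → X) := fun p => (mix p.1 p.2, mix p.2 p.1)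
  have hσ : Function.Involutive σ := by
    rintro ⟨x, y⟩
    ext i <;> by_cases hi : i ∈ B <;> simp [σ, mix, hi]
  have hL : ∑ x, g x * marg W D (fun i => x i.1) =
      ∑ p : (V → X) × (V → X),
        g p.1 * if ∀ i : {i // i ∈ D}, p.2 i.1 = p.1 i.1 then W p.2 else 0 := by
    rw [Fintype.sum_prod_type]
    simp only [marg, Finset.mul_sum]
  have hR : (Fintype.card X : ℝ) ^ Fintype.card V / (Fintype.card X : ℝ) ^ D.card *
        ∑ x, g x * W x =
      ∑ p : (V → X) × (V → X),
        g p.1 * W p.1 * if ∀ i : {i // i ∈ D}, p.2 i.1 = p.1 i.1 then (1 : ℝ) else 0 := by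
    rw [Fintype.sum_prod_type, Finset.mul_sum]
    refine Finset.sum_congr rfl fun x _ => ?_
    dsimp only
    rw [← Finset.mul_sum, sum_indicator_eqOn, mul_comm]
  rw [hL, hR]
  refine Fintype.sum_equiv hσ.toPerm _ _ ?_
  rintro ⟨x, y⟩
  have hgx : g (mix x y) = g x := hg _ _ fun i hi => by simp [mix, hi]
  have hiff : (∀ i : {i // i ∈ D}, mix y x i.1 = mix x y i.1) ↔
      ∀ i : {i // i ∈ D}, y i.1 = x i.1 :=
    forall_congr' fun i => by simp [mix, hDB i.2]
  simp only [Function.Involutive.coe_toPerm, σ, hgx, hiff]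
  split_ifs with h
  · have hWy : W (mix x y) = W y := hW _ _ fun i hi => by
      by_cases hiB : i ∈ B
      · simp [mix, hiB, h ⟨i, hi.resolve_left (not_not.2 hiB)⟩]
      · simp [mix, hiB]
    rw [hWy, mul_one]
  · simp

lemma marg_const_mul (c : ℝ) (μ : (V → X) → ℝ) (S : Finset V) (y : {i // i ∈ S} → X) :
    marg (fun x => c * μ x) S y = c * marg μ S y := by
  simp only [marg, Finset.mul_sum, mul_ite, mul_zero]

lemma marg_gibbs (W : (V → X) → ℝ) (S : Finset V) (y : {i // i ∈ S} → X) :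
    marg (gibbs W) S y = marg W S y / ∑ x, W x := by
  have h : gibbs W = fun x => (∑ x, W x)⁻¹ * W x := funext fun x => by
    rw [gibbs, div_eq_inv_mul]
  rw [h, marg_const_mul, div_eq_inv_mul]

/-- Marginals inside `B` of the Gibbs measures with weights `W₁` and `W₁ * W₂` are close
when the marginal of the Gibbs measure with weight `W₂` on the interface `D` is nearly
uniform. -/
lemma sum_abs_marg_gibbs_mul_sub_le [Nonempty X] {B D S : Finset V} (hDB : D ⊆ B) (hS : S ⊆ B)
    {W₁ W₂ : (V → X) → ℝ} (hpos₁ : ∀ x, 0 < W₁ x) (hpos₂ : ∀ x, 0 < W₂ x)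
    (hW₁ : ∀ x y : V → X, (∀ i ∈ B, x i = y i) → W₁ x = W₁ y)
    (hW₂ : ∀ x y : V → X, (∀ i, i ∉ B ∨ i ∈ D → x i = y i) → W₂ x = W₂ y) :
    ∑ y, |marg (gibbs fun x => W₁ x * W₂ x) S y - marg (gibbs W₁) S y| ≤
      2 * ((Fintype.card X : ℝ) ^ D.card *
        ∑ z : {i // i ∈ D} → X,
          |marg (gibbs W₂) D z - 1 / (Fintype.card X : ℝ) ^ D.card|) := by
  set q : ℝ := (Fintype.card X : ℝ) with hqdef
  have hq : 0 < q := by rw [hqdef]; exact_mod_cast Fintype.card_pos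
  have hqD : 0 < q ^ D.card := pow_pos hq _
  set μ := gibbs fun x => W₁ x * W₂ x with hμ
  set P := gibbs W₁ with hP
  have hpos : ∀ x, 0 < W₁ x * W₂ x := fun x => mul_pos (hpos₁ x) (hpos₂ x)
  have hZ₁ := sum_weight_pos hpos₁
  have hZ₂ := sum_weight_pos hpos₂
  have hZ := sum_weight_pos hpos
  set Δ := ∑ z : {i // i ∈ D} → X, |marg (gibbs W₂) D z - 1 / q ^ D.card| with hΔ
  let f : (V → X) → ℝ := fun x => q ^ D.card * marg (gibbs W₂) D (fun i => x i.1)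
  have hf : ∀ x, |f x - 1| ≤ q ^ D.card * Δ := by
    intro x
    have h : f x - 1 = q ^ D.card *
        (marg (gibbs W₂) D (fun i => x i.1) - 1 / q ^ D.card) := by
      simp only [f]
      field_simp
    rw [h, abs_mul, abs_of_pos hqD]
    refine mul_le_mul_of_nonneg_left ?_ hqD.le
    exact Finset.single_le_sum
      (f := fun z : {i // i ∈ D} → X => |marg (gibbs W₂) D z - 1 / q ^ D.card|)
      (fun _ _ => abs_nonneg _) (Finset.mem_univ _)
  obtain ⟨c, hc⟩ : ∃ c : ℝ, ∀ g : (V → X) → ℝ,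
      (∀ x y : V → X, (∀ i ∈ B, x i = y i) → g x = g y) →
        ∑ x, g x * (P x * f x) = c * ∑ x, g x * μ x := by
    refine ⟨q ^ Fintype.card V * (∑ x, W₁ x * W₂ x) / ((∑ x, W₁ x) * ∑ x, W₂ x),
      fun g hg => ?_⟩
    have key := sum_mul_marg hDB (g := fun x => g x * W₁ x) (W := W₂)
      (fun x y h => by rw [hg x y h, hW₁ x y h]) hW₂
    rw [← hqdef] at key
    have hl : ∑ x, g x * (P x * f x) = q ^ D.card / ((∑ x, W₁ x) * ∑ x, W₂ x) *
        ∑ x, g x * W₁ x * marg W₂ D (fun i => x i.1) := by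
      rw [Finset.mul_sum]
      refine Finset.sum_congr rfl fun x _ => ?_
      simp only [f, hP, marg_gibbs, gibbs]
      field_simp
    have hr : ∑ x, g x * μ x = (∑ x, g x * W₁ x * W₂ x) / ∑ x, W₁ x * W₂ x := by
      rw [Finset.sum_div]
      refine Finset.sum_congr rfl fun x _ => ?_
      simp only [hμ, gibbs]
      ring
    rw [hl, hr, key]
    field_simp
  have hPnn : ∀ x, 0 ≤ P x := gibbs_nonneg fun x => (hpos₁ x).le
  have hdist : ∑ x, |P x * f x - P x| ≤ q ^ D.card * Δ := by
    calc ∑ x, |P x * f x - P x| ≤ ∑ x, P x * (q ^ D.card * Δ) := by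
          refine Finset.sum_le_sum fun x _ => ?_
          rw [← mul_sub_one, abs_mul, abs_of_nonneg (hPnn x)]
          exact mul_le_mul_of_nonneg_left (hf x) (hPnn x)
      _ = q ^ D.card * Δ := by rw [← Finset.sum_mul, sum_gibbs hpos₁, one_mul]
  have hcf : ∑ x, P x * f x = c := by
    have h := hc (fun _ => 1) fun _ _ _ => rfl
    simpa [hμ, sum_gibbs hpos] using h
  have hc1 : |c - 1| ≤ q ^ D.card * Δ := by
    rw [← hcf, ← sum_gibbs hpos₁, ← Finset.sum_sub_distrib]
    exact (Finset.abs_sum_le_sum_abs _ _).trans hdist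
  have hmarg : ∀ y, marg (fun x => P x * f x) S y = c * marg μ S y := by
    intro y
    have h := hc (fun x => if ∀ i : {i // i ∈ S}, x i.1 = y i then 1 else 0) fun x x' h => by
      have : (∀ i : {i // i ∈ S}, x i.1 = y i) ↔ ∀ i : {i // i ∈ S}, x' i.1 = y i :=
        forall_congr' fun i => by rw [h i.1 (hS i.2)]
      simp only [this]
    simpa only [marg, ite_mul, one_mul, zero_mul] using h
  have hμmarg : ∀ y, 0 ≤ marg μ S y := marg_nonneg (gibbs_nonneg fun x => (hpos x).le) S
  calc ∑ y, |marg μ S y - marg P S y|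
      ≤ ∑ y, (|marg (fun x => P x * f x) S y - marg P S y| + |c - 1| * marg μ S y) := by
        refine Finset.sum_le_sum fun y _ => ?_
        have h : marg μ S y - marg P S y =
            (c * marg μ S y - marg P S y) - (c - 1) * marg μ S y := by ring
        rw [hmarg, h]
        refine (abs_sub _ _).trans_eq ?_
        rw [abs_mul (c - 1), abs_of_nonneg (hμmarg y)]
    _ ≤ q ^ D.card * Δ + q ^ D.card * Δ := by
        rw [Finset.sum_add_distrib, ← Finset.mul_sum, sum_marg, hμ, sum_gibbs hpos, mul_one]
        exact add_le_add ((sum_abs_marg_sub_le _ _ S).trans hdist) hc1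
    _ = 2 * (q ^ D.card * Δ) := by ring

end FiniteMarginals

/-- In the edge-disjoint decomposition setting, for `r ∈ B` and
`U ⊆ B` with `r ∉ U`,
`| ‖μ_{{r}∪U} − μ_r ⊗ μ_U‖_TV − ‖μ^<_{{r}∪U} − μ^<_r ⊗ μ^<_U‖_TV |
   ≤ 9 |X|^{2|B|} ‖μ^>_D − ρ_D‖_TV`. -/
theorem stmt_3 {V X : Type*} [Fintype V] [DecidableEq V] [Fintype X]
    [DecidableEq X] [Nonempty X]
    (ψ : V → V → X → X → ℝ)
    (hsym : ∀ i j a b, ψ i j a b = ψ j i b a)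
    (hpos : ∀ i j a b, 0 < ψ i j a b)
    (E E₁ E₂ : Finset (Sym2 V)) (hE : E = E₁ ∪ E₂) (hdisj : Disjoint E₁ E₂)
    (B D : Finset V)
    (hB : ∀ e ∈ E₁, ∀ i ∈ e, i ∈ B)
    (hD : ∀ i : V, i ∈ D ↔ i ∈ B ∧ ∃ e ∈ E₂, i ∈ e)
    (hE₂ : ∀ e ∈ E₂, ∀ i ∈ e, i ∉ B ∨ i ∈ D)
    (r : V) (hr : r ∈ B) (U : Finset V) (hU : U ⊆ B) (hrU : r ∉ U) :
    |(1 / 2) * (∑ y : {i // i ∈ insert r U} → X,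
        |marg (gibbs (edgeW ψ hsym E)) (insert r U) y -
          marg (gibbs (edgeW ψ hsym E)) {r}
              (fun _ => y ⟨r, Finset.mem_insert_self r U⟩) *
            marg (gibbs (edgeW ψ hsym E)) U
              (fun i => y ⟨i.1, Finset.mem_insert_of_mem i.2⟩)|) -
      (1 / 2) * (∑ y : {i // i ∈ insert r U} → X,
        |marg (gibbs (edgeW ψ hsym E₁)) (insert r U) y -
          marg (gibbs (edgeW ψ hsym E₁)) {r}
              (fun _ => y ⟨r, Finset.mem_insert_self r U⟩) *
            marg (gibbs (edgeW ψ hsym E₁)) U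
              (fun i => y ⟨i.1, Finset.mem_insert_of_mem i.2⟩)|)|
      ≤ 9 * (Fintype.card X : ℝ) ^ (2 * B.card) *
        ((1 / 2) * ∑ z : {i // i ∈ D} → X,
          |marg (gibbs (edgeW ψ hsym E₂)) D z -
            1 / (Fintype.card X : ℝ) ^ D.card|) := by
  have hDB : D ⊆ B := fun i hi => ((hD i).1 hi).1
  have hpos₁ := edgeW_pos ψ hsym hpos E₁
  have hpos₂ := edgeW_pos ψ hsym hpos E₂
  have hpos' := edgeW_pos ψ hsym hpos E
  have hmul : edgeW ψ hsym E = fun x => edgeW ψ hsym E₁ x * edgeW ψ hsym E₂ x :=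
    funext fun x => by rw [hE, edgeW, Finset.prod_union hdisj]; rfl
  have hclose : ∀ S ⊆ B, _ := fun S hS =>
    sum_abs_marg_gibbs_mul_sub_le hDB hS hpos₁ hpos₂
      (fun x y h => edgeW_congr ψ hsym E₁ fun e he i hi => h i (hB e he i hi))
      (fun x y h => edgeW_congr ψ hsym E₂ fun e he i hi => h i (hE₂ e he i hi))
  rw [← hmul] at hclose
  set μ := gibbs (edgeW ψ hsym E) with hμ
  set P := gibbs (edgeW ψ hsym E₁) with hP
  set Δ := ∑ z : {i // i ∈ D} → X, |marg (gibbs (edgeW ψ hsym E₂)) D z -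
    1 / (Fintype.card X : ℝ) ^ D.card| with hΔ
  have hμmarg : ∀ S y, 0 ≤ marg μ S y := marg_nonneg (gibbs_nonneg fun x => (hpos' x).le)
  have hPmarg : ∀ S y, 0 ≤ marg P S y := marg_nonneg (gibbs_nonneg fun x => (hpos₁ x).le)
  have hJ := hclose (insert r U) (Finset.insert_subset hr hU)
  have hb := sum_insert_mul_le r U (hμmarg {r}) (fun b => abs_nonneg (marg μ U b - marg P U b))
  have ha := sum_insert_mul_le r U (fun a => abs_nonneg (marg μ {r} a - marg P {r} a)) (hPmarg U)
  rw [sum_marg, hμ, sum_gibbs hpos', one_mul, ← hμ] at hb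
  rw [sum_marg, hP, sum_gibbs hpos₁, mul_one, ← hP] at ha
  have hb' := hb.trans (hclose U hU)
  have ha' := ha.trans (hclose {r} (Finset.singleton_subset_iff.2 hr))
  have hΔ0 : 0 ≤ Δ := Finset.sum_nonneg fun _ _ => abs_nonneg _
  have hpow : (Fintype.card X : ℝ) ^ D.card ≤ (Fintype.card X : ℝ) ^ (2 * B.card) := by
    refine pow_le_pow_right₀ (by exact_mod_cast Fintype.card_pos) ?_
    have := Finset.card_le_card hDB
    omega
  have hbound := mul_le_mul_of_nonneg_right hpow hΔ0
  have hnn : 0 ≤ (Fintype.card X : ℝ) ^ (2 * B.card) * Δ := by positivity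
  rw [← mul_sub, ← Finset.sum_sub_distrib, abs_mul, abs_of_pos (by norm_num : (0 : ℝ) < 1 / 2)]
  have hmain := (Finset.abs_sum_le_sum_abs _ Finset.univ).trans (Finset.sum_le_sum
    fun (y : {i // i ∈ insert r U} → X) _ => abs_abs_sub_mul_sub_abs_sub_mul_le
      (J := marg μ (insert r U) y) (J' := marg P (insert r U) y)
      (b := marg μ U (fun i => y ⟨i.1, Finset.mem_insert_of_mem i.2⟩))
      (a' := marg P {r} (fun _ => y ⟨r, Finset.mem_insert_self r U⟩))
      (hμmarg {r} (fun _ => y ⟨r, Finset.mem_insert_self r U⟩))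
      (hPmarg U (fun i => y ⟨i.1, Finset.mem_insert_of_mem i.2⟩)))
  rw [Finset.sum_add_distrib, Finset.sum_add_distrib] at hmain
  linarith
end
end

section
/- Let k ≥ 1 and t ≥ 0 be integers, θ ∈ (0,1), λ ∈ [0,1). Let G be the graph obtained from two disjoint rooted k-ary trees of depth t, with roots i and j (every vertex of depth < t has exactly k children, leaves are the depth-t vertices), by adding the edge (i,j). Define a probability distribution on σ : V(G) → {−1,+1} by P(σ) ∝ Π_{(u,v) edge of G}(1+θσ_uσ_v) · Π_{v ∈ V(G)}(1+λσ_v). Then E[σ_iσ_j] = (θ + h²)/(1 + θh²), where h = f_{θ,λ}^{∘t}(λ). -/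
noncomputable section

/-- The spin value `±1` associated to a Boolean. -/
def spin (b : Bool) : ℝ := if b then 1 else -1

/-- The tree recursion `f_{θ,λ}` for the Ising model on the `k`-ary tree. -/
def treeF (k : ℕ) (θ lam : ℝ) (h : ℝ) : ℝ :=
  ((1 + lam) * (1 + θ * h) ^ k - (1 - lam) * (1 - θ * h) ^ k) /
    ((1 + lam) * (1 + θ * h) ^ k + (1 - lam) * (1 - θ * h) ^ k)

/-- Spin configurations of the rooted `k`-ary tree of depth `t`, organized by
level: the vertices at depth `m` are the paths `Fin m → Fin k` from the root
(the root is the empty path at level `m = 0`). -/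
def Cfg (k t : ℕ) : Type := ∀ m : Fin (t + 1), (Fin (m : ℕ) → Fin k) → Bool

instance (k t : ℕ) : Fintype (Cfg k t) := by unfold Cfg; infer_instance
instance (k t : ℕ) : DecidableEq (Cfg k t) := by unfold Cfg; infer_instance

/-- The spin at the root (the empty path at level `0`). -/
def rootB (k t : ℕ) (σ : Cfg k t) : Bool := σ ⟨0, Nat.succ_pos t⟩ Fin.elim0

/-- Product of the edge factors `1 + θ σ_v σ_c` over all parent–child edges:
the child at level `m+1` with path `q` has parent the level-`m` restriction of
`q`. -/
def edgeProd (k t : ℕ) (θ : ℝ) (σ : Cfg k t) : ℝ :=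
  ∏ m : Fin t, ∏ q : Fin ((m : ℕ) + 1) → Fin k,
    (1 + θ * spin (σ ⟨(m : ℕ), Nat.lt_succ_of_lt m.isLt⟩
          (fun i => q ⟨(i : ℕ), Nat.lt_succ_of_lt i.isLt⟩)) *
        spin (σ ⟨(m : ℕ) + 1, Nat.succ_lt_succ m.isLt⟩ q))

/-- Product of the factors `1 + λ σ_v` over the non-leaf vertices (levels
`0, …, t−1`). -/
def innerProd (k t : ℕ) (lam : ℝ) (σ : Cfg k t) : ℝ :=
  ∏ m : Fin t, ∏ p : Fin (m : ℕ) → Fin k,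
    (1 + lam * spin (σ ⟨(m : ℕ), Nat.lt_succ_of_lt m.isLt⟩ p))

/-- Product of the factors `1 + h₀ σ_ℓ` over the leaves (level `t`). -/
def leafProd (k t : ℕ) (h₀ : ℝ) (σ : Cfg k t) : ℝ :=
  ∏ p : Fin t → Fin k, (1 + h₀ * spin (σ ⟨t, Nat.lt_succ_self t⟩ p))

/-- Product of the factors `1 + λ σ_v` over all vertices of the tree. -/
def allVertexProd (k t : ℕ) (lam : ℝ) (σ : Cfg k t) : ℝ :=
  ∏ m : Fin (t + 1), ∏ p : Fin (m : ℕ) → Fin k, (1 + lam * spin (σ m p))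

/-- All leaves (depth-`t` vertices) carry spin `+1`. -/
def leavesTrue (k t : ℕ) (σ : Cfg k t) : Prop :=
  ∀ p : Fin t → Fin k, σ ⟨t, Nat.lt_succ_self t⟩ p = true

instance (k t : ℕ) (σ : Cfg k t) : Decidable (leavesTrue k t σ) := by
  unfold leavesTrue; infer_instance

/-- A configuration of the tree of depth `t + 1` is a configuration of the tree of depth `t`
together with the spins of the leaves. -/
def cfgSnocEquiv (k t : ℕ) : ((Fin (t + 1) → Fin k) → Bool) × Cfg k t ≃ Cfg k (t + 1) :=
  Fin.snocEquiv fun m : Fin (t + 2) => (Fin (m : ℕ) → Fin k) → Bool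

lemma cfgSnocEquiv_of_lt {k t : ℕ} (x : ((Fin (t + 1) → Fin k) → Bool) × Cfg k t) {m : ℕ}
    (hm : m < t + 2) (hm' : m < t + 1) : cfgSnocEquiv k t x ⟨m, hm⟩ = x.2 ⟨m, hm'⟩ :=
  Fin.snoc_castSucc (α := fun m : Fin (t + 2) => (Fin (m : ℕ) → Fin k) → Bool) x.1 x.2 ⟨m, hm'⟩

lemma cfgSnocEquiv_last {k t : ℕ} (x : ((Fin (t + 1) → Fin k) → Bool) × Cfg k t)
    (hm : t + 1 < t + 2) : cfgSnocEquiv k t x ⟨t + 1, hm⟩ = x.1 :=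
  Fin.snoc_last (α := fun m : Fin (t + 2) => (Fin (m : ℕ) → Fin k) → Bool) x.1 x.2

lemma rootB_cfgSnocEquiv {k t : ℕ} (x : ((Fin (t + 1) → Fin k) → Bool) × Cfg k t) :
    rootB k (t + 1) (cfgSnocEquiv k t x) = rootB k t x.2 := by
  unfold rootB
  rw [cfgSnocEquiv_of_lt x _ t.succ_pos]

lemma edgeProd_cfgSnocEquiv {k t : ℕ} (θ : ℝ) (x : ((Fin (t + 1) → Fin k) → Bool) × Cfg k t) :
    edgeProd k (t + 1) θ (cfgSnocEquiv k t x) =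
      edgeProd k t θ x.2 * ∏ q : Fin (t + 1) → Fin k,
        (1 + θ * spin (x.2 ⟨t, t.lt_succ_self⟩ (Fin.init q)) * spin (x.1 q)) := by
  unfold edgeProd
  rw [Fin.prod_univ_castSucc]
  congr 1
  · refine Finset.prod_congr rfl fun m _ => Finset.prod_congr rfl fun q _ => ?_
    exact congrArg₂
      (fun y z => 1 + θ * spin (y fun i => q ⟨i, Nat.lt_succ_of_lt i.isLt⟩) * spin (z q))
      (cfgSnocEquiv_of_lt x (by lia) (by lia))
      (cfgSnocEquiv_of_lt x _ (Nat.succ_lt_succ m.isLt))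
  · refine Finset.prod_congr rfl fun q _ => ?_
    exact congrArg₂ (fun y z => 1 + θ * spin (y (Fin.init q)) * spin (z q))
      (cfgSnocEquiv_of_lt x (by lia) (by lia))
      (cfgSnocEquiv_last x (t + 1).lt_succ_self)

lemma innerProd_cfgSnocEquiv {k t : ℕ} (lam : ℝ)
    (x : ((Fin (t + 1) → Fin k) → Bool) × Cfg k t) :
    innerProd k (t + 1) lam (cfgSnocEquiv k t x) =
      innerProd k t lam x.2 *
        ∏ p : Fin t → Fin k, (1 + lam * spin (x.2 ⟨t, t.lt_succ_self⟩ p)) := by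
  unfold innerProd
  rw [Fin.prod_univ_castSucc]
  congr 1
  · refine Finset.prod_congr rfl fun m _ => Finset.prod_congr rfl fun q _ => ?_
    exact congrArg (fun y => 1 + lam * spin (y q))
      (cfgSnocEquiv_of_lt x (by lia) (by lia))
  · refine Finset.prod_congr rfl fun q _ => ?_
    exact congrArg (fun y => 1 + lam * spin (y q))
      (cfgSnocEquiv_of_lt x (by lia) (by lia))

lemma leafProd_cfgSnocEquiv {k t : ℕ} (h : ℝ) (x : ((Fin (t + 1) → Fin k) → Bool) × Cfg k t) :
    leafProd k (t + 1) h (cfgSnocEquiv k t x) =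
      ∏ q : Fin (t + 1) → Fin k, (1 + h * spin (x.1 q)) := by
  unfold leafProd
  rw [cfgSnocEquiv_last]

lemma allVertexProd_eq (k t : ℕ) (lam : ℝ) (σ : Cfg k t) :
    allVertexProd k t lam σ = innerProd k t lam σ * leafProd k t lam σ := by
  unfold allVertexProd innerProd leafProd
  rw [Fin.prod_univ_castSucc]
  rfl

lemma prod_comp_init {k t : ℕ} (g : (Fin t → Fin k) → ℝ) :
    ∏ q : Fin (t + 1) → Fin k, g (Fin.init q) = ∏ p, g p ^ k := by
  rw [← (Fin.snocEquiv fun _ : Fin (t + 1) => Fin k).prod_comp, Fintype.prod_prod_type_right]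
  simp [Fin.snocEquiv]

lemma spin_true : spin true = 1 := rfl

lemma spin_false : spin false = -1 := rfl

/-- Summing out the spins of the leaves. -/
lemma sum_leaves {k t : ℕ} (θ h : ℝ) (s : (Fin t → Fin k) → Bool) :
    ∑ τ : (Fin (t + 1) → Fin k) → Bool,
      ∏ q, ((1 + θ * spin (s (Fin.init q)) * spin (τ q)) * (1 + h * spin (τ q))) =
    ∏ p, (2 * (1 + θ * h * spin (s p))) ^ k := by
  rw [← prod_comp_init fun p => 2 * (1 + θ * h * spin (s p)), ← Fintype.prod_sum
    fun (q : Fin (t + 1) → Fin k) b =>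
      (1 + θ * spin (s (Fin.init q)) * spin b) * (1 + h * spin b)]
  refine Finset.prod_congr rfl fun q _ => ?_
  simp only [Fintype.sum_bool, spin_true, spin_false]
  ring

lemma treeF_weights_pos {θ lam h : ℝ} (k : ℕ) (hθ : θ ∈ Set.Ioo (0 : ℝ) 1)
    (hlam : lam ∈ Set.Ico (0 : ℝ) 1) (hh : |h| ≤ 1) :
    0 < (1 + lam) * (1 + θ * h) ^ k ∧ 0 < (1 - lam) * (1 - θ * h) ^ k := by
  obtain ⟨hθ0, hθ1⟩ := hθ
  obtain ⟨hl0, hl1⟩ := hlam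
  obtain ⟨hh0, hh1⟩ := abs_le.1 hh
  have h1 : 0 < 1 + θ * h := by nlinarith
  have h2 : 0 < 1 - θ * h := by nlinarith
  have h3 : 0 < 1 + lam := by linarith
  have h4 : 0 < 1 - lam := by linarith
  exact ⟨by positivity, by positivity⟩

lemma abs_treeF_le {θ lam h : ℝ} (k : ℕ) (hθ : θ ∈ Set.Ioo (0 : ℝ) 1)
    (hlam : lam ∈ Set.Ico (0 : ℝ) 1) (hh : |h| ≤ 1) : |treeF k θ lam h| ≤ 1 := by
  obtain ⟨h1, h2⟩ := treeF_weights_pos k hθ hlam hh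
  rw [treeF, abs_div, abs_of_pos (add_pos h1 h2), div_le_one (add_pos h1 h2), abs_le]
  constructor <;> linarith

lemma vertex_weight_eq {θ lam h : ℝ} (k : ℕ) (hθ : θ ∈ Set.Ioo (0 : ℝ) 1)
    (hlam : lam ∈ Set.Ico (0 : ℝ) 1) (hh : |h| ≤ 1) (b : Bool) :
    (1 + lam * spin b) * (2 * (1 + θ * h * spin b)) ^ k =
      2 ^ k * (((1 + lam) * (1 + θ * h) ^ k + (1 - lam) * (1 - θ * h) ^ k) / 2) *
        (1 + treeF k θ lam h * spin b) := by
  obtain ⟨h1, h2⟩ := treeF_weights_pos k hθ hlam hh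
  have h3 := (add_pos h1 h2).ne'
  rw [mul_pow, treeF]
  cases b
  · simp only [spin_false, mul_neg_one, ← sub_eq_add_neg]
    rw [one_sub_div h3]
    field_simp
    ring
  · simp only [spin_true, mul_one]
    rw [one_add_div h3]
    field_simp
    ring

/-- Up to a factor that does not depend on the root spin, the tree with leaf field `h` acts on its
root as a field `f^{∘t}(h)`. -/
lemma exists_sum_rootB_eq (k t : ℕ) {θ lam : ℝ} (hθ : θ ∈ Set.Ioo (0 : ℝ) 1)
    (hlam : lam ∈ Set.Ico (0 : ℝ) 1) (h : ℝ) (hh : |h| ≤ 1) :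
    ∃ C : ℝ, C ≠ 0 ∧ ∀ φ : Bool → ℝ,
      ∑ σ : Cfg k t, φ (rootB k t σ) *
          (edgeProd k t θ σ * (innerProd k t lam σ * leafProd k t h σ)) =
        C * ∑ b, φ b * (1 + (treeF k θ lam)^[t] h * spin b) := by
  induction t generalizing h with
  | zero =>
    refine ⟨1, one_ne_zero, fun φ => ?_⟩
    let e : Cfg k 0 ≃ Bool :=
      { toFun := rootB k 0
        invFun := fun b _ _ => b
        left_inv := fun σ => by
          funext m p
          obtain rfl : m = 0 := Subsingleton.elim (α := Fin 1) _ _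
          exact congrArg (σ 0) (funext fun i => i.elim0)
        right_inv := fun _ => rfl }
    rw [one_mul]
    refine Fintype.sum_equiv e _ _ fun σ => ?_
    have h0 : ∀ p : Fin 0 → Fin k, σ ⟨0, Nat.lt_succ_self 0⟩ p = rootB k 0 σ := fun p =>
      congrArg (σ 0) (funext fun i => i.elim0)
    simp only [leafProd, h0]
    simp [edgeProd, innerProd]
    rfl
  | succ t ih =>
    obtain ⟨C, hC, ihC⟩ := ih (treeF k θ lam h) (abs_treeF_le k hθ hlam hh)
    obtain ⟨h1, h2⟩ := treeF_weights_pos k hθ hlam hh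
    set A : ℝ := 2 ^ k * (((1 + lam) * (1 + θ * h) ^ k + (1 - lam) * (1 - θ * h) ^ k) / 2)
      with hA
    have hA0 : A ≠ 0 := by positivity
    refine ⟨A ^ Fintype.card (Fin t → Fin k) * C, mul_ne_zero (pow_ne_zero _ hA0) hC,
      fun φ => ?_⟩
    rw [Function.iterate_succ_apply, mul_assoc, ← ihC, ← (cfgSnocEquiv k t).sum_comp,
      Fintype.sum_prod_type_right, Finset.mul_sum]
    refine Finset.sum_congr rfl fun σ _ => ?_
    simp only [rootB_cfgSnocEquiv, edgeProd_cfgSnocEquiv, innerProd_cfgSnocEquiv,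
      leafProd_cfgSnocEquiv]
    have key : (∏ p : Fin t → Fin k, (1 + lam * spin (σ ⟨t, t.lt_succ_self⟩ p))) *
        ∏ p, (2 * (1 + θ * h * spin (σ ⟨t, t.lt_succ_self⟩ p))) ^ k =
        A ^ Fintype.card (Fin t → Fin k) * leafProd k t (treeF k θ lam h) σ := by
      simp only [← Finset.prod_mul_distrib, vertex_weight_eq k hθ hlam hh, ← hA]
      rw [Finset.prod_mul_distrib, Finset.prod_const, Finset.card_univ]
      rfl
    rw [← sum_leaves] at key
    simp only [Finset.prod_mul_distrib] at key
    have key' := congrArg (φ (rootB k t σ) * (edgeProd k t θ σ * innerProd k t lam σ) * ·) key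
    simp only [Finset.mul_sum] at key'
    exact (Finset.sum_congr rfl fun τ _ => by ring).trans (key'.trans (by ring))

/-- Reduction of a sum over two trees to a sum over the two root spins. -/
lemma exists_sum_prod_rootB_eq (k t : ℕ) {θ lam : ℝ} (hθ : θ ∈ Set.Ioo (0 : ℝ) 1)
    (hlam : lam ∈ Set.Ico (0 : ℝ) 1) :
    ∃ C : ℝ, C ≠ 0 ∧ ∀ φ : Bool → Bool → ℝ,
      ∑ c : Cfg k t × Cfg k t, φ (rootB k t c.1) (rootB k t c.2) *
          ((edgeProd k t θ c.1 * allVertexProd k t lam c.1) *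
            (edgeProd k t θ c.2 * allVertexProd k t lam c.2)) =
        C * ∑ a, ∑ b, φ a b * ((1 + (treeF k θ lam)^[t] lam * spin a) *
          (1 + (treeF k θ lam)^[t] lam * spin b)) := by
  obtain ⟨C, hC, h⟩ := exists_sum_rootB_eq k t hθ hlam lam
    (abs_le.2 ⟨by linarith [hlam.1], hlam.2.le⟩)
  refine ⟨C * C, mul_ne_zero hC hC, fun φ => ?_⟩
  simp only [allVertexProd_eq, Fintype.sum_prod_type]
  calc _ = ∑ σ : Cfg k t,
        (fun a => C * ∑ b, φ a b * (1 + (treeF k θ lam)^[t] lam * spin b)) (rootB k t σ) *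
          (edgeProd k t θ σ * (innerProd k t lam σ * leafProd k t lam σ)) := by
        refine Finset.sum_congr rfl fun σ _ => ?_
        simp only [← h, Finset.sum_mul]
        exact Finset.sum_congr rfl fun τ _ => by ring
    _ = _ := by
        rw [h fun a => C * ∑ b, φ a b * (1 + (treeF k θ lam)^[t] lam * spin b)]
        simp only [Fintype.sum_bool]
        ring

/-- Join two disjoint rooted `k`-ary trees of depth `t`, with
roots `i` and `j`, by the edge `(i,j)`; take edge factors `1+θσ_uσ_v` and field
factors `1+λσ_v` on all vertices.  Then
`E[σᵢσⱼ] = (θ + h²)/(1 + θh²)` with `h = f_{θ,λ}^{∘t}(λ)`. -/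
theorem stmt_17 (k t : ℕ) (hk : 1 ≤ k) (θ lam : ℝ)
    (hθ : θ ∈ Set.Ioo (0 : ℝ) 1) (hlam : lam ∈ Set.Ico (0 : ℝ) 1) :
    (∑ c : Cfg k t × Cfg k t,
        ((1 + θ * spin (rootB k t c.1) * spin (rootB k t c.2)) *
            (edgeProd k t θ c.1 * allVertexProd k t lam c.1) *
            (edgeProd k t θ c.2 * allVertexProd k t lam c.2)) *
          (spin (rootB k t c.1) * spin (rootB k t c.2))) /
      (∑ c : Cfg k t × Cfg k t,
        (1 + θ * spin (rootB k t c.1) * spin (rootB k t c.2)) *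
          (edgeProd k t θ c.1 * allVertexProd k t lam c.1) *
          (edgeProd k t θ c.2 * allVertexProd k t lam c.2)) =
    (θ + ((treeF k θ lam)^[t] lam) ^ 2) / (1 + θ * ((treeF k θ lam)^[t] lam) ^ 2) := by
  obtain ⟨C, hC, h⟩ := exists_sum_prod_rootB_eq k t hθ hlam
  have hnum := h fun a b => (1 + θ * spin a * spin b) * (spin a * spin b)
  have hden := h fun a b => 1 + θ * spin a * spin b
  set x := (treeF k θ lam)^[t] lam
  rw [← mul_div_mul_left (θ + x ^ 2) (1 + θ * x ^ 2) (mul_ne_zero hC four_ne_zero)]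
  congr 1
  · refine (Finset.sum_congr rfl fun c _ => by ring).trans (hnum.trans ?_)
    simp [spin]
    ring
  · refine (Finset.sum_congr rfl fun c _ => by ring).trans (hden.trans ?_)
    simp [spin]
    ring
end
end
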